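/- For every integer n ≥ 0, M_ω(1,5,5n+4) − M_ω(4,5,5n+4) = 2·M_ω(3,5,5n+4) − 2·M_ω(2,5,5n+4). -/

import Mathlib

/-!
Common definitions: for a partition `π` of `n`,
`numParts` is the number of parts, `largestPart` the largest part,
`omegaOnes` the number of parts equal to 1, `rank` and `crank` the
Dyson rank and Andrews–Garvan crank.  `NT m j n` is the total number of
parts over partitions of `n` with rank ≡ m (mod j), and `Mw m j n` is
the total number of ones over partitions of `n` with crank ≡ m (mod j).
`poch a q = (a; q)_∞ = ∏_{n ≥ 0} (1 - a qⁿ)`.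
-/

namespace Beck

/-- number of parts of a partition -/
def numParts {n : ℕ} (π : n.Partition) : ℕ := Multiset.card π.parts

/-- largest part of a partition (0 for the empty partition) -/
def largestPart {n : ℕ} (π : n.Partition) : ℕ := π.parts.sup

/-- number of ones in a partition -/
def omegaOnes {n : ℕ} (π : n.Partition) : ℕ := π.parts.count 1

/-- number of parts strictly larger than the number of ones -/
def muParts {n : ℕ} (π : n.Partition) : ℕ :=
  Multiset.card (π.parts.filter fun x => omegaOnes π < x)

/-- Dyson's rank: largest part minus number of parts -/
def rank {n : ℕ} (π : n.Partition) : ℤ :=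
  (largestPart π : ℤ) - (numParts π : ℤ)

/-- the Andrews–Garvan crank -/
def crank {n : ℕ} (π : n.Partition) : ℤ :=
  if omegaOnes π = 0 then (largestPart π : ℤ)
  else (muParts π : ℤ) - (omegaOnes π : ℤ)

/-- `NT m j n`: total number of parts in partitions of `n` with rank ≡ m (mod j) -/
def NT (m j n : ℕ) : ℤ :=
  ∑ π : n.Partition,
    if rank π % (j : ℤ) = (m : ℤ) % (j : ℤ) then (numParts π : ℤ) else 0

/-- `Mw m j n`: total number of ones in partitions of `n` with crank ≡ m (mod j) -/
def Mw (m j n : ℕ) : ℤ :=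
  ∑ π : n.Partition,
    if crank π % (j : ℤ) = (m : ℤ) % (j : ℤ) then (omegaOnes π : ℤ) else 0

/-- `(a; q)_∞ = ∏_{n ≥ 0} (1 - a qⁿ)` -/
noncomputable def poch (a q : ℂ) : ℂ := ∏' n : ℕ, (1 - a * q ^ n)

section Preliminaries

open Finset PowerSeries

section QProducts

variable {A : Type*} [CommRing A]

/-- The truncated product `(aq; q)_N = ∏_{1 ≤ j ≤ N} (1 - a q ^ j)`. -/
def qProd (q : A) (N : ℕ) (a : A) : A := ∏ j ∈ range N, (1 - a * q ^ (j + 1))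

lemma qProd_succ (q : A) (N : ℕ) (a : A) :
    qProd q (N + 1) a = qProd q N a * (1 - a * q ^ (N + 1)) :=
  prod_range_succ _ _

lemma qProd_eq_of_le {q : A} {N : ℕ} (hq : q ^ N = 0) (a : A) {M : ℕ} (h : N ≤ M) :
    qProd q M a = qProd q N a := by
  induction M, h using Nat.le_induction with
  | base => rfl
  | succ M hM ih =>
    rw [qProd_succ, ih, pow_eq_zero_of_le (by omega : N ≤ M + 1) hq]
    ring

lemma isUnit_one_sub_mul_pow {q : A} {N : ℕ} (hq : q ^ N = 0) (a : A) (j : ℕ) :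
    IsUnit (1 - a * q ^ (j + 1)) := by
  refine IsNilpotent.isUnit_one_sub ⟨N, ?_⟩
  rw [mul_pow, ← pow_mul, mul_comm (j + 1), pow_mul, hq, zero_pow (by omega), mul_zero]

lemma isUnit_qProd {q : A} {N : ℕ} (hq : q ^ N = 0) (a : A) (M : ℕ) : IsUnit (qProd q M a) := by
  induction M with
  | zero => simp [qProd]
  | succ M ih => rw [qProd_succ]; exact ih.mul (isUnit_one_sub_mul_pow hq a M)

/-- The Gaussian binomial coefficient with integer lower index, by the `q`-Pascal rule. -/
def gaussBinom (q : A) : ℕ → ℤ → A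
  | 0, k => if k = 0 then 1 else 0
  | n + 1, k => gaussBinom q n (k - 1) + q ^ k.toNat * gaussBinom q n k

lemma gaussBinom_eq_zero (q : A) (n : ℕ) (k : ℤ) (h : k < 0 ∨ n < k) : gaussBinom q n k = 0 := by
  induction n generalizing k with
  | zero => simp only [gaussBinom]; rw [if_neg]; omega
  | succ n ih =>
    simp only [gaussBinom]
    rw [ih _ (by omega), ih _ (by omega)]
    ring

lemma gaussBinom_mul_qProd (q : A) (a b : ℕ) :
    gaussBinom q (a + b) a * qProd q a 1 * qProd q b 1 = qProd q (a + b) 1 := by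
  obtain ⟨n, hn⟩ : ∃ n, n = a + b := ⟨_, rfl⟩
  induction n generalizing a b with
  | zero =>
    obtain ⟨rfl, rfl⟩ : a = 0 ∧ b = 0 := by omega
    simp [gaussBinom, qProd]
  | succ n ih =>
    rw [← hn]
    have h1 : gaussBinom q n ((a : ℤ) - 1) * qProd q a 1 * qProd q b 1
        = qProd q n 1 * (1 - q ^ a) := by
      rcases a with _ | a
      · rw [gaussBinom_eq_zero _ _ _ (by left; simp)]; simp
      · have := ih a b (by omega)
        rw [show a + b = n by omega] at this
        rw [qProd_succ, ← this]
        push_cast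
        rw [add_sub_cancel_right]
        ring
    have h2 : gaussBinom q n a * qProd q a 1 * qProd q b 1 = qProd q n 1 * (1 - q ^ b) := by
      rcases b with _ | b
      · rw [gaussBinom_eq_zero _ _ _ (by right; omega)]; simp
      · have := ih a b (by omega)
        rw [show a + b = n by omega] at this
        rw [qProd_succ q b, ← this]
        ring
    simp only [gaussBinom, Int.toNat_natCast]
    rw [qProd_succ, add_mul, add_mul, h1, mul_assoc (q ^ a), mul_assoc (q ^ a), h2, hn, pow_add]
    ring

/-- The exponent `k (k - 1) / 2` of the theta series. -/
def triExp (k : ℤ) : ℕ := (k * (k - 1) / 2).toNat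

lemma two_mul_triExp (k : ℤ) : 2 * (triExp k : ℤ) = k * (k - 1) := by
  have h : 0 ≤ k * (k - 1) := by
    rcases le_or_gt k 0 with h | h <;> nlinarith
  have h2 : (2 : ℤ) ∣ k * (k - 1) := by
    simpa using (Int.even_mul_pred_self k).two_dvd
  rw [triExp, Int.toNat_of_nonneg (by omega)]
  omega

lemma gaussBinom_succ' (q : A) (n : ℕ) (k : ℤ) :
    gaussBinom q (n + 1) k
      = gaussBinom q n k + q ^ (n + 1 - k).toNat * gaussBinom q n (k - 1) := by
  induction n generalizing k with
  | zero =>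
    by_cases h0 : k = 0
    · subst h0; simp [gaussBinom]
    by_cases h1 : k = 1
    · subst h1; simp [gaussBinom]
    have : k - 1 ≠ 0 := by omega
    simp [gaussBinom, h0, this]
  | succ n ih =>
    have hdef : ∀ j k, gaussBinom q (j + 1) k
      = gaussBinom q j (k - 1) + q ^ k.toNat * gaussBinom q j k := fun _ _ => rfl
    by_cases h : 1 ≤ k ∧ k ≤ n + 1
    · have L := hdef (n + 1) k
      rw [ih k, ih (k - 1)] at L
      rw [L, hdef n k, hdef n (k - 1)]
      have e1 : ((n : ℤ) + 1 - (k - 1)).toNat = ((n + 1 : ℕ) + 1 - k : ℤ).toNat := by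
        congr 1; push_cast; ring
      have e2 : q ^ k.toNat * q ^ ((n : ℤ) + 1 - k).toNat
          = q ^ ((n + 1 : ℕ) + 1 - k : ℤ).toNat * q ^ (k - 1).toNat := by
        rw [← pow_add, ← pow_add]; congr 1; omega
      rw [e1]
      linear_combination gaussBinom q n (k - 1) * e2
    · rw [hdef (n + 1)]
      by_cases h0 : k ≤ 0
      · rw [gaussBinom_eq_zero _ _ (k - 1) (by omega)]
        rcases h0.lt_or_eq with h0 | h0
        · rw [gaussBinom_eq_zero _ _ k (by omega)]; simp
        · subst h0; simp
      · rw [gaussBinom_eq_zero _ _ k (by push_cast; omega)]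
        rw [show ((n + 1 : ℕ) + 1 - k : ℤ).toNat = 0 by omega]
        simp

/-- A finite form of the Jacobi triple product identity; `p k` plays the role of `z ^ k`. -/
lemma prod_mul_prod_eq_finsum (q z z' : A) (p : ℤ → A) (hp0 : p 0 = 1)
    (hp : ∀ k, p (k + 1) = z * p k) (hz : z' * z = 1) (m n : ℕ) :
    qProd q m z' * ∏ j ∈ range n, (1 - z * q ^ j)
      = ∑ᶠ k : ℤ, (k.negOnePow : A) * q ^ triExp k * gaussBinom q (m + n) (m + k) * p k := by
  have hfin : ∀ (m n : ℕ) (s : ℤ) (g : ℤ → A),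
      (∀ k, gaussBinom q (m + n) (m + k + s) = 0 → g k = 0) → g.HasFiniteSupport := by
    intro m n s g hg
    refine (Set.finite_Icc (-(m : ℤ) - s) (n - s)).subset fun k hk => ?_
    by_contra h
    refine hk (hg k (gaussBinom_eq_zero _ _ _ ?_))
    simp only [Set.mem_Icc, not_and_or, not_le] at h
    push_cast
    omega
  have hf (m n : ℕ) : Function.HasFiniteSupport fun k : ℤ =>
      (k.negOnePow : A) * q ^ triExp k * gaussBinom q (m + n) (m + k) * p k :=
    hfin m n 0 _ fun k hk => by rw [add_zero] at hk; rw [hk]; ring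
  induction m with
  | zero =>
    induction n with
    | zero =>
      rw [finsum_eq_single _ 0]
      · simp [qProd, gaussBinom, hp0, triExp]
      · intro k hk
        simp [gaussBinom, hk]
    | succ n ih =>
      rw [prod_range_succ, ← mul_assoc, ih, mul_sub, mul_one, mul_comm _ (z * q ^ n),
        mul_finsum' _ _ (hf _ _),
        ← finsum_comp_equiv (Equiv.subRight (1 : ℤ)) (f := fun k => z * q ^ n * _),
        ← finsum_sub_distrib]
      · refine finsum_congr fun k => ?_
        simp only [Equiv.subRight_apply]
        rw [← add_assoc, gaussBinom_succ']
        by_cases hk : 1 ≤ k ∧ k ≤ n + 1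
        · have hpk := hp (k - 1)
          rw [sub_add_cancel] at hpk
          have h1 := two_mul_triExp k
          have h2 := two_mul_triExp (k - 1)
          have e : q ^ triExp k * q ^ ((0 + n : ℕ) + 1 - ((0 : ℕ) + k) : ℤ).toNat
              = q ^ triExp (k - 1) * q ^ n := by
            rw [← pow_add, ← pow_add]
            congr 1
            zify
            rw [Int.toNat_of_nonneg (by omega)]
            linarith
          have hs : ((k - 1).negOnePow : A) = - (k.negOnePow : A) := by
            rw [Int.negOnePow_sub]; simp
          rw [hs, hpk]
          simp only [Nat.cast_zero, zero_add] at e ⊢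
          linear_combination -(k.negOnePow : A) * gaussBinom q n (k - 1) * z * p (k - 1) * e
        · rw [gaussBinom_eq_zero q (0 + n) (((0 : ℕ) : ℤ) + k - 1) (by push_cast; omega),
            gaussBinom_eq_zero q (0 + n) (((0 : ℕ) : ℤ) + (k - 1)) (by push_cast; omega)]
          ring
      · exact hf 0 n
      · refine hfin 0 n (-1) _ fun k hk => ?_
        rw [add_assoc] at hk
        simp only [Equiv.subRight_apply, sub_eq_add_neg, hk]
        ring
  | succ m ih =>
    rw [qProd_succ, mul_right_comm, ih, mul_sub, mul_one, mul_comm _ (z' * q ^ (m + 1)),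
        mul_finsum' _ _ (hf _ _),
        ← finsum_comp_equiv (Equiv.addRight (1 : ℤ)) (f := fun k => z' * q ^ (m + 1) * _),
        ← finsum_sub_distrib]
    · refine finsum_congr fun k => ?_
      simp only [Equiv.coe_addRight]
      rw [show m + 1 + n = m + n + 1 by omega]
      simp only [gaussBinom]
      push_cast
      rw [show (m : ℤ) + 1 + k - 1 = m + k by ring, show (m : ℤ) + (k + 1) = m + 1 + k by ring]
      by_cases hk : 0 ≤ m + 1 + k
      · have h1 := two_mul_triExp k
        have h2 := two_mul_triExp (k + 1)
        have e : q ^ triExp k * q ^ (m + 1 + k : ℤ).toNat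
            = q ^ (m + 1) * q ^ triExp (k + 1) := by
          rw [← pow_add, ← pow_add]
          congr 1
          zify
          rw [Int.toNat_of_nonneg (by omega)]
          linarith
        have hs : ((k + 1).negOnePow : A) = - (k.negOnePow : A) := by
          rw [Int.negOnePow_succ]; simp
        rw [hs, hp k]
        linear_combination (k.negOnePow : A) * gaussBinom q (m + n) (m + 1 + k) * p k
          * (q ^ (m + 1) * q ^ triExp (k + 1) * hz - e)
      · rw [gaussBinom_eq_zero q (m + n) (m + 1 + k) (by omega)]
        ring
    · exact hf m n
    · refine hfin m n 1 _ fun k hk => ?_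
      rw [add_assoc] at hk
      simp only [Equiv.coe_addRight, hk]
      ring

/-- The truncated theta series `∑ (-1) ^ k q ^ (k (k - 1) / 2) p k`. -/
noncomputable def thetaSum (q : A) (N : ℕ) (p : ℤ → A) : A :=
  ∑ k ∈ Icc (-(2 * N : ℤ)) (2 * N + 1), (k.negOnePow : A) * q ^ triExp k * p k

/-- The Jacobi triple product identity for a nilpotent nome `q`. -/
lemma jacobi_triple_product {q : A} {N : ℕ} (hq : q ^ N = 0) {z z' : A} {p : ℤ → A}
    (hp0 : p 0 = 1) (hp : ∀ k, p (k + 1) = z * p k) (hz : z' * z = 1) :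
    qProd q N 1 * qProd q N z * qProd q N z' * (1 - z) = thetaSum q N p := by
  have h := prod_mul_prod_eq_finsum q z z' p hp0 hp hz (2 * N) (2 * N + 1)
  rw [prod_range_succ', qProd_eq_of_le hq z' (by omega : N ≤ 2 * N)] at h
  change _ * (qProd q (2 * N) z * _) = _ at h
  rw [qProd_eq_of_le hq z (by omega : N ≤ 2 * N),
    finsum_eq_sum_of_support_subset (s := Icc (-(2 * N : ℤ)) (2 * N + 1))] at h
  · calc _ = qProd q N 1 * (qProd q N z' * (qProd q N z * (1 - z * q ^ 0))) := by ring
      _ = _ := by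
        rw [h, thetaSum, mul_sum]
        refine sum_congr rfl fun k hk => ?_
        by_cases hkN : -(N : ℤ) ≤ k ∧ k ≤ N
        · obtain ⟨a, ha⟩ := Int.eq_ofNat_of_zero_le (a := 2 * N + k) (by omega)
          obtain ⟨b, hb⟩ := Int.eq_ofNat_of_zero_le (a := 2 * N + 1 - k) (by omega)
          have hg := gaussBinom_mul_qProd q a b
          rw [qProd_eq_of_le hq _ (by omega : N ≤ a), qProd_eq_of_le hq _ (by omega : N ≤ b),
            qProd_eq_of_le hq _ (by omega : N ≤ a + b), ← ha,
            show a + b = 2 * N + (2 * N + 1) by omega] at hg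
          have hg' := (isUnit_qProd hq 1 N).mul_right_cancel (hg.trans (one_mul _).symm)
          push_cast
          linear_combination (k.negOnePow : A) * q ^ triExp k * p k * hg'
        · have h1 := two_mul_triExp k
          have : N ≤ triExp k := by
            zify
            rcases lt_or_ge k (-N) with h | h
            · nlinarith
            · have : (N : ℤ) + 1 ≤ k := by omega
              nlinarith
          rw [pow_eq_zero_of_le this hq]
          ring
  · intro k hk
    by_contra hk'
    refine hk ?_
    simp only [coe_Icc, Set.mem_Icc, not_and_or, not_le] at hk'
    simp only
    rw [gaussBinom_eq_zero, mul_zero, zero_mul]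
    push_cast
    omega

end QProducts

section QBinomial
variable {A : Type*} [CommRing A]

lemma qProd_mul_sum_eq {q : A} {N : ℕ} (hq : q ^ N = 0) (x y : A) (t : ℕ → A) (ht0 : t 0 = 1)
    (ht : ∀ k, t (k + 1) * (1 - q ^ (k + 1)) = t k * (1 - x * q ^ (k + 1))) :
    qProd q N y * ∑ k ∈ range N, t k * (y * q) ^ k = qProd q N (q * x * y) := by
  have step : ∀ i, (1 - y * q ^ (i + 1)) * ∑ k ∈ range N, t k * (y * q ^ (i + 1)) ^ k
      = (1 - q * x * y * q ^ (i + 1)) * ∑ k ∈ range N, t k * (y * q ^ (i + 2)) ^ k := by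
    intro i
    have : ∀ n, (1 - y * q ^ (i + 1)) * ∑ k ∈ range (n + 1), t k * (y * q ^ (i + 1)) ^ k
      + t n * (y * q ^ (i + 1)) ^ (n + 1)
      = (1 - q * x * y * q ^ (i + 1)) * ∑ k ∈ range (n + 1), t k * (y * q ^ (i + 2)) ^ k
      + x * q ^ (n + 1) * t n * (y * q ^ (i + 1)) ^ (n + 1) := by
      intro n
      induction n with
      | zero => simp; ring
      | succ n ih =>
        rw [sum_range_succ, sum_range_succ _ (n + 1), mul_add, mul_add]
        have e : (y * q ^ (i + 2)) ^ (n + 1) = (y * q ^ (i + 1)) ^ (n + 1) * q ^ (n + 1) := by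
          rw [← mul_pow]; ring
        rw [e]
        linear_combination ih + (y * q ^ (i + 1)) ^ (n + 1) * ht n
    rcases N with _ | n
    · simp
    · have hz : (y * q ^ (i + 1)) ^ (n + 1) = 0 := by
        rw [mul_pow, ← pow_mul, mul_comm (i + 1), pow_mul, hq, zero_pow (by omega), mul_zero]
      simpa [hz] using this n
  have tele : ∀ M, qProd q M y * ∑ k ∈ range N, t k * (y * q) ^ k
      = qProd q M (q * x * y) * ∑ k ∈ range N, t k * (y * q ^ (M + 1)) ^ k := by
    intro M
    induction M with
    | zero => simp [qProd]
    | succ M ih =>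
      rw [qProd_succ, mul_right_comm, ih, qProd_succ]
      linear_combination qProd q M (q * x * y) * step M
  rw [tele N, pow_succ, hq]
  rcases N with _ | n
  · have : (1 : A) = 0 := by simpa using hq
    rw [← mul_one (_ * _), ← mul_one (qProd _ _ _), this]; simp
  · rw [sum_range_succ']
    simp [ht0]

end QBinomial

section GenFun

variable {R : Type*} [CommRing R]

open scoped PowerSeries.WithPiTopology in
lemma X_pow_dvd_genFun_mul_prod_sub [TopologicalSpace R] [DiscreteTopology R]
    (f : ℕ → ℕ → R) (N : ℕ) (D U : ℕ → R⟦X⟧)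
    (h : ∀ i < N, (1 + ∑' j, f (i + 1) (j + 1) • (X : R⟦X⟧) ^ ((i + 1) * (j + 1))) * D i = U i) :
    (X : R⟦X⟧) ^ N ∣ Nat.Partition.genFun f * ∏ i ∈ range N, D i - ∏ i ∈ range N, U i := by
  set F : ℕ → R⟦X⟧ := fun i => 1 + ∑' j, f (i + 1) (j + 1) • (X : R⟦X⟧) ^ ((i + 1) * (j + 1))
    with hF
  have hprod : HasProd F (Nat.Partition.genFun f) := Nat.Partition.hasProd_genFun f
  have key : (X : R⟦X⟧) ^ N ∣ Nat.Partition.genFun f - ∏ i ∈ range N, F i := by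
    rw [X_pow_dvd_iff]
    intro m hm
    rw [HasProd, WithPiTopology.tendsto_iff_coeff_tendsto] at hprod
    have h1 := hprod m
    rw [SummationFilter.unconditional_filter, nhds_discrete, Filter.tendsto_pure] at h1
    obtain ⟨s, hs, hs'⟩ := (h1.and (Filter.eventually_ge_atTop (range N))).exists
    have h2 : (X : R⟦X⟧) ^ N ∣ ∏ i ∈ s, F i - ∏ i ∈ range N, F i := by
      rw [← prod_sdiff hs', ← sub_one_mul]
      refine Dvd.dvd.mul_right ?_ _
      have : ∀ i ∈ s \ range N, (X : R⟦X⟧) ^ N ∣ F i - 1 := by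
        intro i hi
        simp only [mem_sdiff, mem_range, not_lt] at hi
        rw [hF]
        simp only [add_sub_cancel_left]
        rw [X_pow_dvd_iff]
        intro l hl
        rw [(Nat.Partition.summable_genFun_term f i).map_tsum _
          (WithPiTopology.continuous_coeff _ _)]
        refine (tsum_congr fun j => ?_).trans tsum_zero
        rw [map_smul, coeff_X_pow, if_neg, smul_zero]
        nlinarith
      refine (Finset.prod_induction F (fun g => (X : R⟦X⟧) ^ N ∣ g - 1) ?_ (by simp)
        (s := s \ range N) this)
      intro a b ha hb
      have : a * b - 1 = (a - 1) * b + (b - 1) := by ring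
      rw [this]
      exact dvd_add (ha.mul_right _) hb
    have h3 := (X_pow_dvd_iff.mp h2) m hm
    rw [map_sub] at h3 ⊢
    rw [← hs, h3]
  have : Nat.Partition.genFun f * ∏ i ∈ range N, D i - ∏ i ∈ range N, U i
      = (Nat.Partition.genFun f - ∏ i ∈ range N, F i) * ∏ i ∈ range N, D i := by
    rw [sub_mul, ← prod_mul_distrib, prod_congr rfl fun i hi => h i (mem_range.mp hi)]
  rw [this]
  exact key.mul_right _

end GenFun

section CrankGenFun
variable {R : Type*} [CommRing R]

lemma X_pow_dvd_sub_sum_coeff (N : ℕ) (g : R⟦X⟧) :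
    (X : R⟦X⟧) ^ N ∣ g - ∑ n ∈ range N, C (coeff n g) * X ^ n := by
  rw [X_pow_dvd_iff]
  intro m hm
  rw [map_sub, map_sum, sum_eq_single m]
  · simp
  · intro b _ hb
    rw [coeff_C_mul, coeff_X_pow, if_neg hb.symm, mul_zero]
  · intro h
    exact absurd (mem_range.mpr hm) h

/-- The weight of a part `i` of multiplicity `c` used to enumerate the partitions with `k` ones
by the number of parts exceeding `k`. -/
def crankWeight (x : R) (k : ℕ) (v : R) (i c : ℕ) : R :=
  if i = 1 then (if c = k then v else 0) else if k < i then x ^ c else 1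

lemma pow_card_filter_lt (x : R) (k : ℕ) (s : Multiset ℕ) :
    x ^ Multiset.card (s.filter fun i => k < i)
      = ∏ i ∈ s.toFinset, if k < i then x ^ s.count i else 1 := by
  have h := Finset.prod_multiset_map_count s fun i => if k < i then x else 1
  simp only [ite_pow, one_pow] at h
  rw [← h]
  induction s using Multiset.induction with
  | empty => simp
  | cons a s ih =>
    by_cases ha : k < a
    · simp [ha, pow_succ', ih (Finset.prod_multiset_map_count s _ |>.trans (by simp [ite_pow]))]
    · simp [ha, ih (Finset.prod_multiset_map_count s _ |>.trans (by simp [ite_pow]))]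

lemma prod_crankWeight_sub {n : ℕ} (p : n.Partition) (x v : R) {k : ℕ} (hk : 1 ≤ k) :
    p.parts.toFinsupp.prod (crankWeight x k v) - p.parts.toFinsupp.prod (crankWeight x k 0)
      = if omegaOnes p = k then v * x ^ muParts p else 0 := by
  have hprod : ∀ w : R, p.parts.toFinsupp.prod (crankWeight x k w)
      = ∏ i ∈ p.parts.toFinset, crankWeight x k w i (p.parts.count i) := by
    intro w
    simp [Finsupp.prod]
  rw [hprod, hprod]
  by_cases h1 : 1 ∈ p.parts
  · have h1' : 1 ∈ p.parts.toFinset := by simpa using h1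
    rw [← mul_prod_erase _ _ h1', ← mul_prod_erase _ (fun i => crankWeight x k 0 i _) h1']
    have hw : ∀ w : R, ∏ i ∈ p.parts.toFinset.erase 1, crankWeight x k w i (p.parts.count i)
        = x ^ Multiset.card (p.parts.filter fun i => k < i) := by
      intro w
      rw [pow_card_filter_lt, ← mul_prod_erase _ _ h1', if_neg (by omega), one_mul]
      refine prod_congr rfl fun i hi => ?_
      simp [crankWeight, ne_of_mem_erase hi]
    rw [hw, hw]
    by_cases hc : omegaOnes p = k
    · subst hc
      simp [crankWeight, omegaOnes, muParts]
    · rw [if_neg hc]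
      rw [omegaOnes] at hc
      simp [crankWeight, hc]
  · have hc : omegaOnes p ≠ k := by
      rw [omegaOnes, Multiset.count_eq_zero_of_notMem h1]; omega
    rw [if_neg hc, sub_eq_zero]
    refine prod_congr rfl fun i hi => ?_
    have : i ≠ 1 := by rintro rfl; exact h1 (by simpa using hi)
    simp [crankWeight, this]

open scoped PowerSeries.WithPiTopology in
lemma X_pow_dvd_genFun_crankWeight [TopologicalSpace R] [DiscreteTopology R] (x v : R) {k N : ℕ}
    (hk : 1 ≤ k) (hN : 0 < N) :
    (X : R⟦X⟧) ^ N ∣ Nat.Partition.genFun (crankWeight x k v)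
      * ∏ i ∈ range N, (if i = 0 then 1 else 1 - C (if k < i + 1 then x else 1) * X ^ (i + 1))
      - (1 + C v * X ^ k) := by
  have := X_pow_dvd_genFun_mul_prod_sub (crankWeight x k v) N
    (fun i => if i = 0 then 1 else 1 - C (if k < i + 1 then x else 1) * X ^ (i + 1))
    (fun i => if i = 0 then 1 + C v * X ^ k else 1) ?_
  · rwa [prod_ite_eq' (range N) 0, if_pos (mem_range.mpr hN)] at this
  intro i _
  rcases i with _ | i
  · simp only [if_true, mul_one, zero_add, one_mul]
    rw [tsum_eq_single (k - 1)]
    · simp [crankWeight, Nat.sub_add_cancel hk, smul_eq_C_mul]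
    · intro j hj
      have : j + 1 ≠ k := by omega
      simp [crankWeight, this]
  · rw [if_neg (Nat.succ_ne_zero i), if_neg (Nat.succ_ne_zero i)]
    set c : R := if k < i + 1 + 1 then x else 1 with hc
    set g : R⟦X⟧ := C c * X ^ (i + 1 + 1) with hg
    have hg0 : g.constantCoeff = 0 := by simp [hg]
    have hterm : ∀ j, crankWeight x k v (i + 1 + 1) (j + 1) • (X : R⟦X⟧) ^ ((i + 1 + 1) * (j + 1))
        = g ^ (j + 1) := by
      intro j
      rw [hg, mul_pow, ← pow_mul, ← map_pow, smul_eq_C_mul]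
      congr 2
      rw [hc, crankWeight, if_neg (by omega)]
      split_ifs <;> simp
    simp_rw [hterm]
    have h1 := WithPiTopology.tsum_pow_mul_one_sub_of_constantCoeff_eq_zero hg0
    have hs := WithPiTopology.summable_pow_of_constantCoeff_eq_zero hg0
    rw [hs.tsum_eq_zero_add, pow_zero] at h1
    exact h1

/-- The sum of `x ^ muParts p * y ^ omegaOnes p` over the partitions of `n` containing a one. -/
noncomputable def crankSum (x y : R) (n : ℕ) : R :=
  ∑ p : n.Partition, if omegaOnes p = 0 then 0 else x ^ muParts p * y ^ omegaOnes p

variable {A : Type*} [CommRing A]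

lemma qProd_mul_crankSum_aux (φ : R⟦X⟧ →+* A) {N : ℕ} (hN : 0 < N) (hq : φ X ^ N = 0) (x y : R)
    {k : ℕ} (hk : 1 ≤ k) (hkN : k ≤ N) :
    qProd (φ X) k 1 * (qProd (φ X) N (φ (C x)) * ∑ n ∈ range N,
      φ (C (∑ p : n.Partition, if omegaOnes p = k then y ^ k * x ^ muParts p else 0)) * φ X ^ n)
      = (1 - φ X) * (qProd (φ X) k (φ (C x)) * (φ (C y) * φ X) ^ k) := by
  let : TopologicalSpace R := ⊥
  have : DiscreteTopology R := ⟨rfl⟩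
  set q := φ X with hqdef
  have hφ : ∀ g h : R⟦X⟧, (X : R⟦X⟧) ^ N ∣ g - h → φ g = φ h := by
    rintro g h ⟨r, hr⟩
    rw [← sub_eq_zero, ← map_sub, hr, map_mul, map_pow, hq, zero_mul]
  set P := Nat.Partition.genFun (crankWeight x k (y ^ k)) -
    Nat.Partition.genFun (crankWeight x k 0) with hP
  have hsum : ∑ n ∈ range N,
      φ (C (∑ p : n.Partition, if omegaOnes p = k then y ^ k * x ^ muParts p else 0)) * q ^ n
      = φ P := by
    rw [hφ _ _ (X_pow_dvd_sub_sum_coeff N P), map_sum]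
    refine sum_congr rfl fun n _ => ?_
    rw [map_mul, map_pow, hP, map_sub, Nat.Partition.coeff_genFun, Nat.Partition.coeff_genFun,
      ← sum_sub_distrib]
    simp_rw [prod_crankWeight_sub _ x (y ^ k) hk]
    rfl
  have hprod := congrArg₂ (· - ·) (hφ _ _ (X_pow_dvd_genFun_crankWeight x (y ^ k) hk hN))
    (hφ _ _ (X_pow_dvd_genFun_crankWeight x 0 hk hN))
  rw [map_mul, map_mul, ← sub_mul, ← map_sub, ← hP] at hprod
  set D := φ (∏ i ∈ range N,
    (if i = 0 then 1 else 1 - C (if k < i + 1 then x else 1) * X ^ (i + 1))) with hD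
  have hD' : (1 - q) * D * qProd q k (φ (C x)) = qProd q k 1 * qProd q N (φ (C x)) := by
    have : ∀ M, 0 < M → (1 - q) * (∏ i ∈ range M,
        (if i = 0 then 1 else 1 - φ (C (if k < i + 1 then x else 1)) * q ^ (i + 1)))
        * qProd q (min k M) (φ (C x)) = qProd q (min k M) 1 * qProd q M (φ (C x)) := by
      intro M hM
      induction M, hM using Nat.le_induction with
      | base => simp [hk, qProd]
      | succ M hM ih =>
        rw [prod_range_succ, if_neg (by omega), qProd_succ q M]
        by_cases h : k < M + 1
        · rw [if_pos h, min_eq_left (by omega)]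
          rw [min_eq_left (by omega)] at ih
          linear_combination (1 - φ (C x) * q ^ (M + 1)) * ih
        · rw [if_neg h, min_eq_right (by omega), qProd_succ, qProd_succ]
          rw [min_eq_right (by omega)] at ih
          rw [map_one, map_one]
          linear_combination (1 - φ (C x) * q ^ (M + 1)) * (1 - q ^ (M + 1)) * ih
    have h := this N hN
    rw [min_eq_left hkN] at h
    rw [← h, hD, map_prod]
    congr 2
    refine prod_congr rfl fun i _ => ?_
    split_ifs <;> simp [hqdef]
  rw [hsum]
  simp only [map_add, map_one, map_mul, map_pow, map_zero, zero_mul, add_zero,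
    add_sub_cancel_left, ← hqdef] at hprod
  rw [mul_pow]
  linear_combination (-φ P) * hD' + (1 - q) * qProd q k (φ (C x)) * hprod

lemma omegaOnes_le {n : ℕ} (p : n.Partition) : omegaOnes p ≤ n := by
  have h := Multiset.card_nsmul_le_sum (s := p.parts) (a := 1) fun i hi => p.parts_pos hi
  rw [p.parts_sum, smul_eq_mul, mul_one] at h
  exact (Multiset.count_le_card _ _).trans h

/-- The generating function of `crankSum`. -/
lemma qProd_mul_qProd_mul_crankSum (φ : R⟦X⟧ →+* A) {N : ℕ} (hN : 0 < N) (hq : φ X ^ N = 0)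
    (x y : R) :
    qProd (φ X) N (φ (C x)) * qProd (φ X) N (φ (C y))
        * ∑ n ∈ range N, φ (C (crankSum x y n)) * φ X ^ n
      = (1 - φ X) * (qProd (φ X) N (φ X * φ (C x) * φ (C y)) - qProd (φ X) N (φ (C y))) := by
  set t : ℕ → A := fun k => qProd (φ X) k (φ (C x)) * Ring.inverse (qProd (φ X) k 1) with ht
  have hu := fun k => isUnit_qProd hq 1 k
  have ht0 : t 0 = 1 := by simp [ht, qProd]
  have hbin := qProd_mul_sum_eq hq (φ (C x)) (φ (C y)) t ht0 fun k => by
    have h1 := Ring.mul_inverse_cancel _ (hu k)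
    have h2 := Ring.mul_inverse_cancel _ (hu (k + 1))
    refine (hu k).mul_left_cancel ?_
    simp only [ht]
    rw [qProd_succ, one_mul] at h2
    rw [qProd_succ, qProd_succ, one_mul]
    linear_combination qProd (φ X) k (φ (C x)) * (1 - φ (C x) * φ X ^ (k + 1)) * (h2 - h1)
  obtain ⟨M, rfl⟩ : ∃ M, N = M + 1 := ⟨N - 1, by omega⟩
  have hsum : ∑ n ∈ range (M + 1), φ (C (crankSum x y n)) * φ X ^ n
      = ∑ k ∈ range M, ∑ n ∈ range (M + 1), φ (C (∑ p : n.Partition,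
        if omegaOnes p = k + 1 then y ^ (k + 1) * x ^ muParts p else 0)) * φ X ^ n := by
    rw [sum_comm]
    refine sum_congr rfl fun n hn => ?_
    rw [← sum_mul, ← map_sum, ← map_sum, sum_comm, crankSum]
    congr 3
    refine sum_congr rfl fun p _ => ?_
    have := omegaOnes_le p
    have hn := mem_range.mp hn
    split_ifs with h
    · rw [sum_eq_zero]
      intro k _
      rw [if_neg (by omega)]
    · rw [sum_eq_single (omegaOnes p - 1)]
      · rw [Nat.sub_add_cancel (by omega), if_pos rfl, mul_comm]
      · intro k _ hk
        rw [if_neg (by omega)]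
      · intro hk
        exact absurd (mem_range.mpr (by omega)) hk
  have hk : ∀ k ∈ range M, qProd (φ X) (M + 1) (φ (C x)) * ∑ n ∈ range (M + 1),
      φ (C (∑ p : n.Partition,
        if omegaOnes p = k + 1 then y ^ (k + 1) * x ^ muParts p else 0)) * φ X ^ n
      = (1 - φ X) * (t (k + 1) * (φ (C y) * φ X) ^ (k + 1)) := by
    intro k hk
    have hk := mem_range.mp hk
    have h := qProd_mul_crankSum_aux φ hN hq x y (k := k + 1) (by omega) (by omega)
    have h1 := Ring.mul_inverse_cancel _ (hu (k + 1))
    refine (hu (k + 1)).mul_left_cancel ?_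
    rw [h]
    simp only [ht]
    linear_combination (-(1 - φ X) * (qProd (φ X) (k + 1) (φ (C x))
      * (φ (C y) * φ X) ^ (k + 1))) * h1
  rw [mul_right_comm, hsum, mul_sum, sum_congr rfl hk, ← mul_sum, ← hbin, sum_range_succ', ht0]
  ring

end CrankGenFun

section Perturbation
variable {A : Type*} [CommRing A]

lemma exists_qProd_mul_one_add (q : A) (N : ℕ) (a : A) {e : A} (he : e ^ 2 = 0) :
    ∃ d, ∀ c, qProd q N (a * (1 + c * e)) = qProd q N a + c * e * d := by
  induction N with
  | zero => exact ⟨0, fun c => by simp [qProd]⟩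
  | succ N ih =>
    obtain ⟨d, hd⟩ := ih
    refine ⟨d * (1 - a * q ^ (N + 1)) - a * q ^ (N + 1) * qProd q N a, fun c => ?_⟩
    rw [qProd_succ, qProd_succ, hd]
    linear_combination (-c ^ 2 * a * d * q ^ (N + 1)) * he

lemma one_sub_mul_qProd_self {q : A} {N : ℕ} (hq : q ^ N = 0) :
    (1 - q) * qProd q N q = qProd q N 1 := by
  rw [← qProd_eq_of_le hq 1 N.le_succ]
  have : ∀ M, (1 - q) * qProd q M q = qProd q (M + 1) 1 := by
    intro M
    induction M with
    | zero => simp [qProd]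
    | succ M ih =>
      rw [qProd_succ, ← mul_assoc, ih, qProd_succ q (M + 1)]
      ring
  exact this N

lemma prod_qProd_eq (q : A) (N : ℕ) {z : A} (hz : 1 + z + z ^ 2 + z ^ 3 + z ^ 4 = 0) :
    qProd q N 1 * qProd q N z * qProd q N (z ^ 4) * qProd q N (z ^ 2) * qProd q N (z ^ 3)
      = ∏ j ∈ range N, (1 - q ^ (5 * (j + 1))) := by
  simp only [qProd, ← prod_mul_distrib]
  refine prod_congr rfl fun j _ => ?_
  rw [mul_comm 5, pow_mul]
  generalize q ^ (j + 1) = t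
  have h5 : z ^ 5 = 1 := by linear_combination (z - 1) * hz
  have e1 : (1 - z * t) * (1 - z ^ 4 * t) = 1 - (z + z ^ 4) * t + t ^ 2 := by
    linear_combination t ^ 2 * h5
  have e2 : (1 - z ^ 2 * t) * (1 - z ^ 3 * t) = 1 - (z ^ 2 + z ^ 3) * t + t ^ 2 := by
    linear_combination t ^ 2 * h5
  have e3 : (z + z ^ 4) * (z ^ 2 + z ^ 3) = -1 := by
    linear_combination hz + (z + z ^ 2) * h5
  calc _ = (1 - t) * ((1 - z * t) * (1 - z ^ 4 * t)) * ((1 - z ^ 2 * t) * (1 - z ^ 3 * t)) := by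
        ring
    _ = _ := by
      rw [e1, e2]
      linear_combination (1 - t) * t ^ 2 * e3 - (1 - t) * (t + t ^ 3) * hz

end Perturbation

section OnesGenFun
variable {R A : Type*} [CommRing R] [CommRing A]

/-- The generating function of the sums of `omegaOnes p * z ^ crank p`, for `z ^ 5 = 1`. -/
noncomputable def onesGenFun (z : R) : R⟦X⟧ :=
  PowerSeries.mk fun n => ∑ p : n.Partition, (omegaOnes p : R) * z ^ (muParts p + 4 * omegaOnes p)

lemma crankSum_mul_one_add (z : R) {ε : R} (hε : ε ^ 2 = 0) (n : ℕ) :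
    crankSum z (z ^ 4 * (1 + ε)) n = crankSum z (z ^ 4) n + ε * coeff n (onesGenFun z) := by
  rw [onesGenFun, coeff_mk, crankSum, crankSum, mul_sum, ← sum_add_distrib]
  refine sum_congr rfl fun p _ => ?_
  have hpow : ∀ k : ℕ, (1 + ε) ^ k = 1 + k * ε := by
    intro k
    induction k with
    | zero => simp
    | succ k ih =>
      rw [pow_succ, ih]
      push_cast
      linear_combination (k : R) * hε
  split_ifs with h
  · simp [h]
  · rw [mul_pow, hpow]
    ring

lemma thetaSum_add (q : A) (N : ℕ) (p p' : ℤ → A) :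
    thetaSum q N (fun k => p k + p' k) = thetaSum q N p + thetaSum q N p' := by
  simp [thetaSum, mul_add, sum_add_distrib]

lemma thetaSum_mul_left (q : A) (N : ℕ) (c : A) (p : ℤ → A) :
    thetaSum q N (fun k => c * p k) = c * thetaSum q N p := by
  simp only [thetaSum, mul_sum]
  exact sum_congr rfl fun k _ => by ring

lemma map_thetaSum {B : Type*} [CommRing B] (f : A →+* B) (q : A) (N : ℕ) (p : ℤ → A) :
    f (thetaSum q N p) = thetaSum (f q) N (fun k => f (p k)) := by
  simp [thetaSum]

lemma sum_crankSum_mul_one_add (φ : R⟦X⟧ →+* A) {N : ℕ} (hq : φ X ^ N = 0) (z : R) {ε : R}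
    (hε : ε ^ 2 = 0) :
    ∑ n ∈ range N, φ (C (crankSum z (z ^ 4 * (1 + ε)) n)) * φ X ^ n
      = ∑ n ∈ range N, φ (C (crankSum z (z ^ 4) n)) * φ X ^ n
        + φ (C ε) * φ (onesGenFun z) := by
  have h : φ (onesGenFun z) = ∑ n ∈ range N, φ (C (coeff n (onesGenFun z))) * φ X ^ n := by
    obtain ⟨r, hr⟩ := X_pow_dvd_sub_sum_coeff N (onesGenFun z)
    have := congrArg φ hr
    rw [map_mul, map_pow, hq, zero_mul, map_sub, sub_eq_zero] at this
    rw [this]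
    simp
  rw [h, mul_sum, ← sum_add_distrib]
  refine sum_congr rfl fun n _ => ?_
  rw [crankSum_mul_one_add z hε]
  simp only [map_add, map_mul]
  ring

lemma mul_onesGenFun_sub (φ : R⟦X⟧ →+* A) {N : ℕ} (hN : 0 < N) (hq : φ X ^ N = 0)
    {z ε : R} (hz : 1 + z + z ^ 2 + z ^ 3 + z ^ 4 = 0) (hε : ε ^ 2 = 0) {P : ℤ → A}
    (hP0 : P 0 = 1) (hP : ∀ k, P (k + 1) = φ (C z) * P k) :
    φ (C ε) * (((1 - φ (C z)) * (1 - φ (C z) ^ 2) * ∏ j ∈ range N, (1 - φ X ^ (5 * (j + 1)))) ^ 2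
        * (φ (onesGenFun z) - φ (onesGenFun (z ^ 4))))
      = φ (C ε) * (thetaSum (φ X) N (fun k => P k ^ 2) ^ 2 *
        ((1 - φ (C z)) * thetaSum (φ X) N (fun k => k * P k)
          + φ (C z) * thetaSum (φ X) N P)) := by
  have h5 : z ^ 5 = 1 := by linear_combination (z - 1) * hz
  have E1 := qProd_mul_qProd_mul_crankSum φ hN hq z (z ^ 4 * (1 + ε))
  have E2 := qProd_mul_qProd_mul_crankSum φ hN hq z (z ^ 4)
  have E3 := qProd_mul_qProd_mul_crankSum φ hN hq (z ^ 4) ((z ^ 4) ^ 4 * (1 + ε))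
  have E4 := qProd_mul_qProd_mul_crankSum φ hN hq (z ^ 4) ((z ^ 4) ^ 4)
  rw [sum_crankSum_mul_one_add φ hq _ hε] at E1 E3
  have h16 : (z ^ 4) ^ 4 = z := by linear_combination (z ^ 11 + z ^ 6 + z) * h5
  rw [h16] at E3 E4
  simp only [map_mul, map_add, map_one, map_pow] at E1 E2 E3 E4
  set S := ∑ n ∈ range N, φ (C (crankSum z (z ^ 4) n)) * φ X ^ n
  set T := ∑ n ∈ range N, φ (C (crankSum (z ^ 4) z n)) * φ X ^ n
  set g := φ (onesGenFun z)
  set h := φ (onesGenFun (z ^ 4))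
  replace hz : 1 + φ (C z) + φ (C z) ^ 2 + φ (C z) ^ 3 + φ (C z) ^ 4 = 0 := by
    simpa using congrArg (fun x => φ (C x)) hz
  replace h5 : φ (C z) ^ 5 = 1 := by simpa using congrArg (fun x => φ (C x)) h5
  replace hε : φ (C ε) ^ 2 = 0 := by simpa using congrArg (fun x => φ (C x)) hε
  generalize φ (C z) = y at *
  generalize φ (C ε) = e at *
  generalize φ X = q at *
  have hself := one_sub_mul_qProd_self hq
  have hprod := prod_qProd_eq q N hz
  rw [← hprod]
  obtain ⟨α, hα⟩ := exists_qProd_mul_one_add q N y hε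
  obtain ⟨β, hβ⟩ := exists_qProd_mul_one_add q N (y ^ 4) hε
  obtain ⟨γ, hγ⟩ := exists_qProd_mul_one_add q N q hε
  have J2 := jacobi_triple_product hq (z := y ^ 2) (z' := y ^ 3) (p := fun k => P k ^ 2)
    (by simp [hP0]) (fun k => by simp only [hP]; ring) (by linear_combination h5)
  have J1 := jacobi_triple_product hq (z := y) (z' := y ^ 4) hP0 hP (by linear_combination h5)
  have J := jacobi_triple_product hq (z := y * (1 + 1 * e)) (z' := y ^ 4 * (1 + (-1) * e))
    (p := fun k => P k + e * (k * P k)) (by simp [hP0])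
    (fun k => by
      simp only [hP]
      push_cast
      linear_combination (-y * k * P k) * hε)
    (by linear_combination (1 - e ^ 2) * h5 - hε)
  rw [thetaSum_add, thetaSum_mul_left, hα, hβ, ← J1] at J
  have r1 : q * y * (y ^ 4 * (1 + e)) = q * (1 + 1 * e) := by
    linear_combination (q * (1 + e)) * h5
  have r2 : q * y * y ^ 4 = q := by linear_combination q * h5
  have r3 : q * y ^ 4 * (y * (1 + e)) = q * (1 + 1 * e) := by
    linear_combination (q * (1 + e)) * h5
  have r4 : q * y ^ 4 * y = q := by linear_combination q * h5
  have r5 : y ^ 4 * (1 + e) = y ^ 4 * (1 + 1 * e) := by ring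
  have r6 : y * (1 + e) = y * (1 + 1 * e) := by ring
  rw [r1, r5, hγ, hβ] at E1
  rw [r2] at E2
  rw [r3, r6, hγ, hα] at E3
  rw [r4] at E4
  rw [← J1, ← J2]
  generalize thetaSum q N (fun k => k * P k) = Θ at *
  clear J1 J2 hα hβ hγ hprod r1 r2 r3 r4 r5 r6
  generalize qProd q N y = a at *
  generalize qProd q N (y ^ 4) = b at *
  generalize qProd q N (y ^ 2) = c at *
  generalize qProd q N (y ^ 3) = d at *
  generalize qProd q N q = F at *
  generalize qProd q N 1 = f at *
  have K1 : e * (a ^ 2 * b ^ 2 * (g - h)) = e * (f * (b * α - a * β)) := by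
    linear_combination (a + e * α) * b * E1 - a * (b + e * β) * E3
      + (a + e * α) * (b + e * β) * (E4 - E2) + e * (b * α - a * β) * hself
      + ((1 - q) * γ * (b * α - a * β)
        - a * b * (α * b + a * β + e * α * β) * (g - h)) * hε
  have K2 : e * ((1 - y) * (f * (b * α - a * β))) = e * (Θ + y * (f * a * b)) := by
    linear_combination J
      + f * (α * β * (1 - y) + (b * α - a * β) * y - α * β * y * e) * hε
  linear_combination (((1 - y) * (1 - y ^ 2) * f * c * d) ^ 2) * K1
    + (1 - y) * ((1 - y ^ 2) * f * c * d) ^ 2 * K2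

end OnesGenFun

section Transfer
variable {K : Type*} [CommRing K]

lemma map_onesGenFun {L : Type*} [CommRing L] (f : K →+* L) (z : K) :
    PowerSeries.map f (onesGenFun z) = onesGenFun (f z) := by
  ext n
  simp [onesGenFun]

lemma map_mul_onesGenFun_sub {L A : Type*} [CommRing L] [CommRing A] (ι : K →+* L)
    (φ : L⟦X⟧ →+* A) {N : ℕ} (hN : 0 < N) (hq : φ X ^ N = 0)
    {z : K} (hz : 1 + z + z ^ 2 + z ^ 3 + z ^ 4 = 0) {ε : L} (hε : ε ^ 2 = 0) {P : ℤ → K}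
    (hP0 : P 0 = 1) (hP : ∀ k, P (k + 1) = z * P k) :
    φ (C ε * PowerSeries.map ι
      (((1 - C z) * (1 - C z ^ 2) * ∏ j ∈ range N, (1 - (X : K⟦X⟧) ^ (5 * (j + 1)))) ^ 2
        * (onesGenFun z - onesGenFun (z ^ 4))
      - thetaSum X N (fun k => C (P k) ^ 2) ^ 2 *
        ((1 - C z) * thetaSum X N (fun k => (k : K⟦X⟧) * C (P k))
          + C z * thetaSum X N fun k => C (P k)))) = 0 := by
  have key := mul_onesGenFun_sub φ hN hq (z := ι z) (by simpa using congrArg ι hz) hε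
    (P := fun k => φ (C (ι (P k)))) (by simp [hP0]) (fun k => by simp [hP])
  obtain ⟨χ, hχ⟩ : ∃ χ : K⟦X⟧ →+* A, ∀ g, φ (PowerSeries.map ι g) = χ g :=
    ⟨φ.comp (PowerSeries.map ι), fun _ => rfl⟩
  have hX : φ X = χ X := by simp [← hχ]
  have hC : ∀ c, φ (C (ι c)) = χ (C c) := by simp [← hχ]
  have hG : ∀ c, φ (onesGenFun (ι c)) = χ (onesGenFun c) := by simp [← hχ, map_onesGenFun]
  simp only [← map_pow ι, hC, hG, hX] at key
  rw [map_mul, hχ]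
  simp only [map_sub, map_mul, map_pow, map_prod, map_one, map_add, map_thetaSum,
    map_intCast] at key ⊢
  linear_combination key

lemma X_pow_dvd_mul_onesGenFun_sub {N : ℕ} (hN : 0 < N) {z : K}
    (hz : 1 + z + z ^ 2 + z ^ 3 + z ^ 4 = 0) {P : ℤ → K} (hP0 : P 0 = 1)
    (hP : ∀ k, P (k + 1) = z * P k) :
    (X : K⟦X⟧) ^ N ∣
      ((1 - C z) * (1 - C z ^ 2) * ∏ j ∈ range N, (1 - (X : K⟦X⟧) ^ (5 * (j + 1)))) ^ 2
        * (onesGenFun z - onesGenFun (z ^ 4))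
      - thetaSum X N (fun k => C (P k) ^ 2) ^ 2 *
        ((1 - C z) * thetaSum X N (fun k => (k : K⟦X⟧) * C (P k))
          + C z * thetaSum X N fun k => C (P k)) := by
  set I := Ideal.span {(X : (DualNumber K)⟦X⟧) ^ N} with hI
  have hq : Ideal.Quotient.mk I X ^ N = 0 := by
    rw [← map_pow, Ideal.Quotient.eq_zero_iff_mem]
    exact Ideal.mem_span_singleton_self _
  have key := map_mul_onesGenFun_sub (L := DualNumber K) (A := (DualNumber K)⟦X⟧ ⧸ I)
    (TrivSqZeroExt.inlHom K K) (Ideal.Quotient.mk I) hN hq hz (ε := DualNumber.eps)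
    (by rw [pow_two, DualNumber.eps_mul_eps]) hP0 hP
  rw [Ideal.Quotient.eq_zero_iff_mem, Ideal.mem_span_singleton, X_pow_dvd_iff] at key
  rw [X_pow_dvd_iff]
  intro m hm
  have := key m hm
  rw [coeff_C_mul, coeff_map] at this
  simpa using congrArg TrivSqZeroExt.snd this

end Transfer

section Residues
variable {K : Type*} [CommRing K]

/-- The power series supported on exponents whose residue class modulo `5` lies in `S`. -/
def supportedMod (K : Type*) [CommRing K] (S : Set (ZMod 5)) : Submodule K K⟦X⟧ where
  carrier := {g | ∀ n : ℕ, (n : ZMod 5) ∉ S → coeff n g = 0}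
  zero_mem' := fun n _ => by simp
  add_mem' := fun {f g} hf hg n hn => by rw [map_add, hf n hn, hg n hn, add_zero]
  smul_mem' := fun c f hf n hn => by rw [map_smul, hf n hn, smul_zero]

lemma supportedMod_mono {S T : Set (ZMod 5)} (h : S ⊆ T) :
    supportedMod K S ≤ supportedMod K T :=
  fun _ hg n hn => hg n fun hS => hn (h hS)

lemma mul_mem_supportedMod {r s : ZMod 5} {f g : K⟦X⟧} (hf : f ∈ supportedMod K {r})
    (hg : g ∈ supportedMod K {s}) : f * g ∈ supportedMod K {r + s} := by
  intro n hn
  rw [coeff_mul]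
  refine sum_eq_zero fun ij hij => ?_
  by_cases hi : (ij.1 : ZMod 5) = r
  · rw [hg, mul_zero]
    rintro hj
    rw [HasAntidiagonal.mem_antidiagonal] at hij
    refine hn ?_
    rw [← hij, Nat.cast_add, hi, Set.mem_singleton_iff.mp hj]
    rfl
  · rw [hf ij.1 hi, zero_mul]

lemma C_mem_supportedMod (c : K) : C c ∈ supportedMod K {0} := by
  intro n hn
  rw [coeff_C, if_neg]
  rintro rfl
  exact hn (by simp)

lemma X_pow_mem_supportedMod (n : ℕ) : (X : K⟦X⟧) ^ n ∈ supportedMod K {(n : ZMod 5)} := by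
  intro m hm
  rw [coeff_X_pow, if_neg]
  rintro rfl
  exact hm rfl

lemma cast_triExp (k : ℤ) : (triExp k : ZMod 5) = 3 * (k * (k - 1)) := by
  have h := congrArg (Int.cast : ℤ → ZMod 5) (two_mul_triExp k)
  push_cast at h
  have h5 : (5 : ZMod 5) = 0 := rfl
  linear_combination 3 * h - (triExp k : ZMod 5) * h5

/-- The part of the theta series with weights `w` indexed by `k ≡ r` modulo `5`. -/
noncomputable def thetaPart (K : Type*) [CommRing K] (N : ℕ) (w : ℤ → ℤ) (r : ZMod 5) : K⟦X⟧ :=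
  thetaSum X N fun k => if (k : ZMod 5) = r then (w k : K⟦X⟧) else 0

lemma thetaPart_mem (N : ℕ) (w : ℤ → ℤ) (r : ZMod 5) :
    thetaPart K N w r ∈ supportedMod K {3 * (r * (r - 1))} := by
  rw [thetaPart, thetaSum]
  refine Submodule.sum_mem _ fun k _ => ?_
  split_ifs with h
  · have h1 : (((k.negOnePow : ℤˣ) : ℤ) : K⟦X⟧) * (w k : K⟦X⟧)
        = C ((((k.negOnePow : ℤˣ) : ℤ) : K) * (w k : K)) := by simp
    rw [mul_right_comm, h1, ← h, ← cast_triExp, ← zero_add (triExp k : ZMod 5)]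
    exact mul_mem_supportedMod (C_mem_supportedMod _) (X_pow_mem_supportedMod _)
  · rw [mul_zero]
    exact Submodule.zero_mem _

lemma thetaSum_eq_sum_thetaPart (N : ℕ) (w : ℤ → ℤ) (c : ZMod 5 → K⟦X⟧) :
    thetaSum X N (fun k => (w k : K⟦X⟧) * c k) = ∑ r, c r * thetaPart K N w r := by
  simp only [thetaPart, thetaSum, mul_sum]
  rw [sum_comm]
  refine sum_congr rfl fun k _ => ?_
  simp only [mul_ite, mul_zero, sum_ite_eq, mem_univ, if_true]
  ring

lemma triExp_one_sub (k : ℤ) : triExp (1 - k) = triExp k := by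
  rw [triExp, triExp]
  congr 2
  ring

lemma thetaPart_one_sub (N : ℕ) (r : ZMod 5) :
    thetaPart K N (fun _ => 1) (1 - r) = - thetaPart K N (fun _ => 1) r := by
  rw [thetaPart, thetaPart, thetaSum, thetaSum, ← sum_neg_distrib]
  refine sum_equiv (Equiv.subLeft 1) (fun k => ?_) fun k _ => ?_
  · simp only [mem_Icc, Equiv.subLeft_apply]
    omega
  · have hs : (1 - k).negOnePow = - k.negOnePow := by
      rw [Int.negOnePow_sub]; simp
    have hr : (((1 - k : ℤ) : ZMod 5) = r) ↔ (k : ZMod 5) = 1 - r := by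
      push_cast
      constructor <;> intro h <;> linear_combination -h
    rw [Equiv.subLeft_apply, triExp_one_sub, hs]
    simp only [hr]
    split_ifs <;> simp

end Residues

section FifthRoot
variable {K : Type*} [Field K] [CharZero K]

lemma pow_val_add_one {K : Type*} [CommRing K] {z : K} (h5 : z ^ 5 = 1) (a : ZMod 5) :
    z ^ (a + 1).val = z * z ^ a.val := by
  have h : ∀ a : ZMod 5, (a + 1).val = a.val + 1 ∨ (a + 1).val = 0 ∧ a.val + 1 = 5 := by decide
  rw [← pow_succ']
  obtain h | ⟨h, h'⟩ := h a
  · rw [h]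
  · rw [h, h', h5, pow_zero]

lemma sum_zmod_five {M : Type*} [AddCommMonoid M] (f : ZMod 5 → M) :
    ∑ r, f r = f 0 + f 1 + f 2 + f 3 + f 4 :=
  Fin.sum_univ_five f

lemma one_sub_ne_zero_of_sum_eq_zero {z : K} (hz : 1 + z + z ^ 2 + z ^ 3 + z ^ 4 = 0) :
    1 - z ≠ 0 := by
  intro h
  obtain rfl : z = 1 := by linear_combination -h
  norm_num at hz

lemma X_pow_dvd_residue_form {N : ℕ} (hN : 0 < N) {z : K}
    (hz : 1 + z + z ^ 2 + z ^ 3 + z ^ 4 = 0) :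
    (X : K⟦X⟧) ^ N ∣ (1 - C z) * ((∏ j ∈ range N, (1 - (X : K⟦X⟧) ^ (5 * (j + 1)))) ^ 2
        * (onesGenFun z - onesGenFun (z ^ 4)))
      - (thetaPart K N (fun _ => 1) 0 + C (z + z ^ 4) * thetaPart K N (fun _ => 1) 2) ^ 2
        * (∑ r : ZMod 5, C (z ^ r.val) * thetaPart K N id r
          + C z * (thetaPart K N (fun _ => 1) 0
            + C (z ^ 2 + z ^ 3) * thetaPart K N (fun _ => 1) 2)) := by
  have h5 : z ^ 5 = 1 := by linear_combination (z - 1) * hz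
  have hz2 : 1 + z ^ 2 + (z ^ 2) ^ 2 + (z ^ 2) ^ 3 + (z ^ 2) ^ 4 = 0 := by
    linear_combination hz + (z + z ^ 3) * h5
  have h := X_pow_dvd_mul_onesGenFun_sub hN hz (P := fun k => z ^ (k : ZMod 5).val) (by simp)
    (fun k => by push_cast; exact pow_val_add_one h5 _)
  have t1 := thetaSum_eq_sum_thetaPart (K := K) N (fun _ => 1) fun r => C (z ^ r.val) ^ 2
  have t2 := thetaSum_eq_sum_thetaPart (K := K) N (fun _ => 1) fun r => C (z ^ r.val)
  have t3 := thetaSum_eq_sum_thetaPart (K := K) N id fun r => C (z ^ r.val)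
  simp only [Int.cast_one, one_mul, id] at t1 t2 t3
  rw [t1, t2, t3] at h
  have s1 : thetaPart K N (fun _ => 1) 1 = - thetaPart K N (fun _ => 1) 0 := by
    simpa using thetaPart_one_sub (K := K) N 0
  have s4 : thetaPart K N (fun _ => 1) 4 = - thetaPart K N (fun _ => 1) 2 :=
    thetaPart_one_sub (K := K) N 2
  have s3 : thetaPart K N (fun _ => 1) 3 = 0 := by
    have : thetaPart K N (fun _ => 1) 3 = - thetaPart K N (fun _ => 1) 3 :=
      thetaPart_one_sub (K := K) N 3
    have h2 : (C 2 : K⟦X⟧) * thetaPart K N (fun _ => 1) 3 = 0 := by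
      rw [map_ofNat]
      linear_combination this
    have h3 := congrArg (C (2 : K)⁻¹ * ·) h2
    rwa [← mul_assoc, ← map_mul, inv_mul_cancel₀ two_ne_zero, map_one, one_mul, mul_zero] at h3
  rw [sum_zmod_five fun r => C (z ^ r.val) ^ 2 * thetaPart K N (fun _ => 1) r,
    sum_zmod_five fun r => C (z ^ r.val) * thetaPart K N (fun _ => 1) r, s1, s3, s4] at h
  simp only [show (0 : ZMod 5).val = 0 from rfl, show (1 : ZMod 5).val = 1 from rfl,
    show (2 : ZMod 5).val = 2 from rfl, show (3 : ZMod 5).val = 3 from rfl,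
    show (4 : ZMod 5).val = 4 from rfl] at h
  have hu := mul_ne_zero (pow_ne_zero 2 (one_sub_ne_zero_of_sum_eq_zero hz2))
    (one_sub_ne_zero_of_sum_eq_zero hz)
  have hC5 : (C z : K⟦X⟧) ^ 5 = 1 := by rw [← map_pow, h5, map_one]
  have h' := h.mul_left (C ((1 - z ^ 2) ^ 2 * (1 - z))⁻¹)
  have hu' : (C ((1 - z ^ 2) ^ 2 * (1 - z))⁻¹ : K⟦X⟧) * ((1 - C z ^ 2) ^ 2 * (1 - C z)) = 1 := by
    rw [← map_one C, ← map_pow, ← map_sub, ← map_pow, ← map_sub, ← map_mul, ← map_mul,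
      inv_mul_cancel₀ hu]
  convert h' using 1
  simp only [map_add, map_pow, pow_zero, pow_one, map_one]
  generalize onesGenFun z - onesGenFun (z ^ 4) = D
  generalize (∏ j ∈ range N, (1 - (X : K⟦X⟧) ^ (5 * (j + 1)))) = E
  generalize thetaPart K N (fun _ => 1) 0 = a0
  generalize thetaPart K N (fun _ => 1) 2 = a2
  generalize ∑ r : ZMod 5, C z ^ r.val * thetaPart K N id r = b
  generalize (C ((1 - z ^ 2) ^ 2 * (1 - z))⁻¹ : K⟦X⟧) = u at *
  generalize (C z : K⟦X⟧) = y at *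
  have e2 : 1 ^ 2 * a0 + y ^ 2 * -a0 + (y ^ 2) ^ 2 * a2 + (y ^ 3) ^ 2 * 0 + (y ^ 4) ^ 2 * -a2
      = (1 - y ^ 2) * (a0 + (y + y ^ 4) * a2) := by
    linear_combination (y - y ^ 3) * a2 * hC5
  have e1 : 1 * a0 + y * -a0 + y ^ 2 * a2 + y ^ 3 * 0 + y ^ 4 * -a2
      = (1 - y) * (a0 + (y ^ 2 + y ^ 3) * a2) := by ring
  rw [e1, e2]
  linear_combination (-((1 - y) * (E ^ 2 * D)
    - (a0 + (y + y ^ 4) * a2) ^ 2 * (b + y * (a0 + (y ^ 2 + y ^ 3) * a2)))) * hu'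

end FifthRoot

section Extraction
variable {K : Type*} [CommRing K]

lemma one_sub_X_pow_mem_supportedMod (N : ℕ) :
    (∏ j ∈ range N, (1 - (X : K⟦X⟧) ^ (5 * (j + 1)))) ∈ supportedMod K {0} := by
  induction N with
  | zero => simpa using C_mem_supportedMod (1 : K)
  | succ N ih =>
    rw [prod_range_succ, ← add_zero (0 : ZMod 5)]
    refine mul_mem_supportedMod ih (Submodule.sub_mem _ ?_ ?_)
    · simpa using C_mem_supportedMod (1 : K)
    · have h : ((5 * (N + 1) : ℕ) : ZMod 5) = 0 := by
        rw [Nat.cast_mul, show ((5 : ℕ) : ZMod 5) = 0 from rfl, zero_mul]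
      simpa only [h] using X_pow_mem_supportedMod (K := K) (5 * (N + 1))

lemma constantCoeff_prod_one_sub_X_pow (N : ℕ) :
    constantCoeff (∏ j ∈ range N, (1 - (X : K⟦X⟧) ^ (5 * (j + 1)))) = 1 := by
  simp [map_prod]

lemma coeff_eq_zero_of_mul {f g : K⟦X⟧} (hf : f ∈ supportedMod K {0})
    (hf0 : constantCoeff f = 1) {N : ℕ} {r : ZMod 5}
    (h : ∀ n < N, (n : ZMod 5) = r → coeff n (f * g) = 0) :
    ∀ n < N, (n : ZMod 5) = r → coeff n g = 0 := by
  intro n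
  induction n using Nat.strong_induction_on with
  | _ n ih =>
    intro hn hr
    rw [← h n hn hr, coeff_mul, sum_eq_single (0, n)]
    · simp [hf0]
    · rintro ⟨i, j⟩ hij hne
      rw [HasAntidiagonal.mem_antidiagonal] at hij
      simp only at hij ⊢
      by_cases hi : (i : ZMod 5) = 0
      · have hi0 : i ≠ 0 := by
          rintro rfl
          exact hne (by simp [← hij])
        rw [ih j (by omega) (by omega), mul_zero]
        rw [← hr, ← hij, Nat.cast_add, hi, zero_add]
      · rw [hf i hi, zero_mul]
    · intro hne
      exact absurd (HasAntidiagonal.mem_antidiagonal.mpr (by simp)) hne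

lemma residue_form_mem (N : ℕ) (z : K) :
    (thetaPart K N (fun _ => 1) 0 + C (z + z ^ 4) * thetaPart K N (fun _ => 1) 2) ^ 2
        * (∑ r : ZMod 5, C (z ^ r.val) * thetaPart K N id r
          + C z * (thetaPart K N (fun _ => 1) 0
            + C (z ^ 2 + z ^ 3) * thetaPart K N (fun _ => 1) 2))
      - C (2 * (z + z ^ 4) * z ^ 3) * (thetaPart K N (fun _ => 1) 0
        * thetaPart K N (fun _ => 1) 2 * thetaPart K N id 3) ∈ supportedMod K {4}ᶜ := by
  have ha0 := thetaPart_mem (K := K) N (fun _ => 1) 0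
  have ha2 := thetaPart_mem (K := K) N (fun _ => 1) 2
  have hb := thetaPart_mem (K := K) N id
  rw [sum_zmod_five]
  generalize thetaPart K N (fun _ => 1) 0 = a at *
  generalize thetaPart K N (fun _ => 1) 2 = c at *
  generalize thetaPart K N id = b at *
  have hC {f : K⟦X⟧} {s : ZMod 5} (u : K) (hf : f ∈ supportedMod K {s}) :
      C u * f ∈ supportedMod K {s} := by
    simpa using mul_mem_supportedMod (C_mem_supportedMod u) hf
  have h0 : C (z ^ 0) * b 0 + C (z ^ 1) * b 1 + C z * a ∈ supportedMod K {0} :=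
    add_mem (add_mem (hC _ (hb 0)) (hC _ (hb 1))) (hC _ ha0)
  have h1 : C (z ^ 2) * b 2 + C (z ^ 4) * b 4 + C (z * (z ^ 2 + z ^ 3)) * c
      ∈ supportedMod K {1} :=
    add_mem (add_mem (hC _ (hb 2)) (hC _ (hb 4))) (hC _ ha2)
  have h3 : C (z ^ 3) * b 3 ∈ supportedMod K {3} := hC _ (hb 3)
  have hlift {f : K⟦X⟧} {s : ZMod 5} (hs : s ≠ 4) (hf : f ∈ supportedMod K {s}) :
      f ∈ supportedMod K {4}ᶜ :=
    supportedMod_mono (by simpa using hs.symm) hf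
  have haa := mul_mem_supportedMod ha0 ha0
  have hac := hC (2 * (z + z ^ 4)) (mul_mem_supportedMod ha0 ha2)
  have hcc := hC ((z + z ^ 4) ^ 2) (mul_mem_supportedMod ha2 ha2)
  have key := add_mem (add_mem (add_mem (add_mem (add_mem (add_mem (add_mem
    (hlift (by decide) (mul_mem_supportedMod haa h0))
    (hlift (by decide) (mul_mem_supportedMod haa h1)))
    (hlift (by decide) (mul_mem_supportedMod haa h3)))
    (hlift (by decide) (mul_mem_supportedMod hac h0)))
    (hlift (by decide) (mul_mem_supportedMod hac h1)))
    (hlift (by decide) (mul_mem_supportedMod hcc h0)))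
    (hlift (by decide) (mul_mem_supportedMod hcc h1)))
    (hlift (by decide) (mul_mem_supportedMod hcc h3))
  convert key using 1
  simp only [show (0 : ZMod 5).val = 0 from rfl, show (1 : ZMod 5).val = 1 from rfl,
    show (2 : ZMod 5).val = 2 from rfl, show (3 : ZMod 5).val = 3 from rfl,
    show (4 : ZMod 5).val = 4 from rfl, map_mul, map_add, map_pow, map_ofNat]
  ring

end Extraction

section Vanishing
variable {K : Type*} [Field K] [CharZero K]

lemma exists_one_sub_inverse {z : K} (hz : 1 + z + z ^ 2 + z ^ 3 + z ^ 4 = 0) :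
    ∃ u, (1 - z) * u = 1 ∧ z + 2 * z ^ 2 - 2 * z ^ 3 - z ^ 4 = (-5 * u ^ 2 * z ^ 3) * (1 - z) := by
  have h5 : z ^ 5 = 1 := by linear_combination (z - 1) * hz
  set u := -(z + 2 * z ^ 2 + 3 * z ^ 3 + 4 * z ^ 4) / 5 with hu
  have hu1 : (1 - z) * u = 1 := by linear_combination (4 / 5 : K) * h5 - (1 / 5 : K) * hz
  have hu2 : 5 * u = -(z + 2 * z ^ 2 + 3 * z ^ 3 + 4 * z ^ 4) := by rw [hu]; ring
  refine ⟨u, hu1, ?_⟩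
  clear_value u
  linear_combination 5 * z ^ 3 * u * hu1 + z ^ 3 * hu2 - 2 * hz - (2 + 3 * z + 4 * z ^ 2) * h5

lemma coeff_onesGenFun_relation {z : K} (hz : 1 + z + z ^ 2 + z ^ 3 + z ^ 4 = 0) (n : ℕ) :
    (z + 2 * z ^ 2 - 2 * z ^ 3 - z ^ 4)
        * coeff (5 * n + 4) (onesGenFun z - onesGenFun (z ^ 4))
      + (z ^ 2 + 2 * z ^ 4 - 2 * z - z ^ 3)
        * coeff (5 * n + 4) (onesGenFun (z ^ 2) - onesGenFun (z ^ 3)) = 0 := by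
  set N := 5 * n + 5 with hN
  have h5 : z ^ 5 = 1 := by linear_combination (z - 1) * hz
  have hz2 : 1 + z ^ 2 + (z ^ 2) ^ 2 + (z ^ 2) ^ 3 + (z ^ 2) ^ 4 = 0 := by
    linear_combination hz + (z + z ^ 3) * h5
  have d1 := X_pow_dvd_residue_form (by omega : 0 < N) hz
  have d2 := X_pow_dvd_residue_form (by omega : 0 < N) hz2
  have m1 := residue_form_mem N z
  have m2 := residue_form_mem N (z ^ 2)
  rw [show (z ^ 2) ^ 4 = z ^ 3 by linear_combination z ^ 3 * h5] at d2 m2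
  set g := onesGenFun z - onesGenFun (z ^ 4)
  set g' := onesGenFun (z ^ 2) - onesGenFun (z ^ 3)
  have hE := one_sub_X_pow_mem_supportedMod (K := K) N
  have hE0 := constantCoeff_prod_one_sub_X_pow (K := K) N
  set E := ∏ j ∈ range N, (1 - (X : K⟦X⟧) ^ (5 * (j + 1)))
  set T := (thetaPart K N (fun _ => 1) 0 * thetaPart K N (fun _ => 1) 2 * thetaPart K N id 3)
  obtain ⟨u, hu1, hu⟩ := exists_one_sub_inverse hz
  obtain ⟨v, hv1, hv⟩ := exists_one_sub_inverse hz2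
  have huv1 : u = (1 + z) * v := by linear_combination (1 + z) * v * hu1 - u * hv1
  have huv : (-5 * u ^ 2 * z ^ 3) * (2 * (z + z ^ 4) * z ^ 3)
      + (-5 * v ^ 2 * (z ^ 2) ^ 3) * (2 * (z ^ 2 + z ^ 3) * (z ^ 2) ^ 3) = 0 := by
    rw [huv1]
    linear_combination (-20 * v ^ 2) * hz
      + (-10 * v ^ 2) * ((1 + z) ^ 2 * (z ^ 2 + z ^ 5 + 1)
        + (z ^ 9 + z ^ 4 + z ^ 10 + z ^ 5 + 1)) * h5
  replace hv : z ^ 2 + 2 * z ^ 4 - 2 * z - z ^ 3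
      = (-5 * v ^ 2 * (z ^ 2) ^ 3) * (1 - z ^ 2) := by
    linear_combination hv + (2 * z + z ^ 3) * h5
  rw [hu, hv]
  generalize -5 * u ^ 2 * z ^ 3 = s at *
  generalize -5 * v ^ 2 * (z ^ 2) ^ 3 = t at *
  have hmem := add_mem (Submodule.smul_mem _ s m1) (Submodule.smul_mem _ t m2)
  have hdvd := dvd_add (d1.mul_left (C s)) (d2.mul_left (C t))
  have hT := congrArg (C : K → K⟦X⟧) huv
  rw [map_zero, map_add, map_mul, map_mul C t] at hT
  rw [X_pow_dvd_iff] at hdvd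
  have hEE := mul_mem_supportedMod hE hE
  rw [add_zero] at hEE
  have hgoal := coeff_eq_zero_of_mul (g := C (s * (1 - z)) * g + C (t * (1 - z ^ 2)) * g') hEE
    (by rw [map_mul, hE0, one_mul]) (N := N) (r := 4) (fun m hm hr => ?_) (5 * n + 4) (by omega)
    (by push_cast; rw [show (5 : ZMod 5) = 0 from rfl]; ring)
  · rw [map_add, coeff_C_mul, coeff_C_mul] at hgoal
    exact hgoal
  · have h1 := hdvd m hm
    have h2 := hmem m (by simp [hr])
    rw [smul_eq_C_mul, smul_eq_C_mul] at h2
    have h3 := congrArg₂ (· + ·) h1 h2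
    simp only [add_zero] at h3
    rw [← map_add] at h3
    refine Eq.trans (congrArg _ ?_) h3
    simp only [map_mul, map_sub, map_one, map_pow] at hT ⊢
    linear_combination T * hT

end Vanishing

lemma coeff_onesGenFun_eq {K : Type*} [CommRing K] {z : K} (h5 : z ^ 5 = 1) (n : ℕ) :
    coeff n (onesGenFun z) = Mw 0 5 n + Mw 1 5 n * z + Mw 2 5 n * z ^ 2 + Mw 3 5 n * z ^ 3
      + Mw 4 5 n * z ^ 4 := by
  simp only [onesGenFun, coeff_mk, Mw, Int.cast_sum, sum_mul, ← sum_add_distrib]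
  refine sum_congr rfl fun p _ => ?_
  by_cases h : omegaOnes p = 0
  · simp [h]
  · rw [← Nat.div_add_mod (muParts p + 4 * omegaOnes p) 5, pow_add, pow_mul, h5, one_pow, one_mul]
    rw [crank, if_neg h]
    have hr : ((muParts p : ℤ) - omegaOnes p) % 5
        = ((muParts p + 4 * omegaOnes p) % 5 : ℕ) := by omega
    have hlt := Nat.mod_lt (muParts p + 4 * omegaOnes p) (by norm_num : 0 < 5)
    push_cast at hr ⊢
    rw [hr]
    norm_cast
    generalize (muParts p + 4 * omegaOnes p) % 5 = r at *
    interval_cases r <;> simp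

end Preliminaries

/-- For every `n ≥ 0`,
`Mω(1,5,5n+4) − Mω(4,5,5n+4) = 2 Mω(3,5,5n+4) − 2 Mω(2,5,5n+4)`. -/
theorem statement_2 (n : ℕ) :
    Mw 1 5 (5 * n + 4) - Mw 4 5 (5 * n + 4)
      = 2 * Mw 3 5 (5 * n + 4) - 2 * Mw 2 5 (5 * n + 4) := by
  obtain ⟨z, hz⟩ : ∃ z : ℂ, 1 + z + z ^ 2 + z ^ 3 + z ^ 4 = 0 := by
    have h := (Complex.isPrimitiveRoot_exp 5 (by norm_num)).geom_sum_eq_zero (by norm_num)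
    exact ⟨_, by simpa [Finset.sum_range_succ] using h⟩
  have h5 : z ^ 5 = 1 := by linear_combination (z - 1) * hz
  have hpow (k : ℕ) : (z ^ k) ^ 5 = 1 := by rw [← pow_mul, mul_comm, pow_mul, h5, one_pow]
  have h := coeff_onesGenFun_relation hz n
  rw [map_sub, map_sub, coeff_onesGenFun_eq h5, coeff_onesGenFun_eq (hpow 4),
    coeff_onesGenFun_eq (hpow 2), coeff_onesGenFun_eq (hpow 3)] at h
  generalize Mw 0 5 (5 * n + 4) = m0 at *
  generalize Mw 1 5 (5 * n + 4) = m1 at *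
  generalize Mw 2 5 (5 * n + 4) = m2 at *
  generalize Mw 3 5 (5 * n + 4) = m3 at *
  generalize Mw 4 5 (5 * n + 4) = m4 at *
  have e1 : (z ^ 4) ^ 2 = z ^ 3 := by linear_combination z ^ 3 * h5
  have e2 : (z ^ 4) ^ 3 = z ^ 2 := by linear_combination (z ^ 7 + z ^ 2) * h5
  have e3 : (z ^ 4) ^ 4 = z := by linear_combination (z ^ 11 + z ^ 6 + z) * h5
  have e4 : (z ^ 2) ^ 2 = z ^ 4 := by ring
  have e5 : (z ^ 2) ^ 3 = z := by linear_combination z * h5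
  have e6 : (z ^ 2) ^ 4 = z ^ 3 := by linear_combination z ^ 3 * h5
  have e7 : (z ^ 3) ^ 2 = z := by linear_combination z * h5
  have e8 : (z ^ 3) ^ 3 = z ^ 4 := by linear_combination z ^ 4 * h5
  have e9 : (z ^ 3) ^ 4 = z ^ 2 := by linear_combination (z ^ 7 + z ^ 2) * h5
  rw [e1, e2, e3, e4, e5, e6, e7, e8, e9] at h
  have hC : (m1 : ℂ) - m4 = 2 * m3 - 2 * m2 := by
    linear_combination (-1 / 5 : ℂ) * h
      + (1 / 5 : ℂ) * (m1 - m4 + 2 * (m2 - m3)) * (hz + (z ^ 3 + z - 4) * h5)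
  exact_mod_cast hC

end Beck
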